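/- arXiv:2509.20137 — 2 statements merged into one kernel-verified Lean document; each statement's English description precedes it below -/
import Mathlib

section
/- Let 𝒜 be an abelian category with enough projective objects, let M be an object of 𝒜 and let P• be a deleted projective resolution of M. Suppose there are integers n ≥ 2 and m ≥ 0 and a chain map g• : P• → P•[n] (that is, morphisms g_i : P_i → P_{i−n} commuting with the differentials, with g_i = 0 for i < n) whose induced morphism on syzygies Ω^{n+m}(M) → Ω^{m}(M) is an isomorphism. Then qpd_𝒜(M) ≤ m. -/
/-!
Quasi-projective dimension, following Gheibi–Jorgensen–Takahashi and
Chen–Chen–Liu, "Properties of quasi-projective dimension over abelian categories".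
-/

open CategoryTheory CategoryTheory.Limits

attribute [local instance] CategoryTheory.Abelian.hasFiniteBiproducts

noncomputable section

universe v u

namespace QPD

variable {A : Type*} [Category A] [Abelian A]

/-- The direct sum of `n` copies of `M`. -/
def copies (M : A) (n : ℕ) : A := ⨁ (fun _ : Fin n => M)

/-- `X` belongs to `add M`: it is a direct summand of a finite direct sum of copies of `M`. -/
def inAdd (M X : A) : Prop :=
  ∃ (n : ℕ) (s : X ⟶ copies M n) (r : copies M n ⟶ X), s ≫ r = 𝟙 X

/-- `P` is a quasi-projective resolution of `M`: a bounded-below complex of projective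
objects whose `j`-th homology is a direct sum of `mult j` copies of `M`, where the
multiplicities `mult j` are not all zero. -/
structure IsQuasiProjRes (M : A) (P : ChainComplex A ℤ) : Prop where
  projective : ∀ i, Projective (P.X i)
  bddBelow : ∃ a : ℤ, ∀ i, i < a → IsZero (P.X i)
  homology_iso : ∃ mult : ℤ → ℕ, (∃ j, mult j ≠ 0) ∧
    ∀ j, Nonempty (P.homology j ≅ copies M (mult j))

/-- `P` is a finite (i.e. bounded) quasi-projective resolution of `M`. -/
structure IsFiniteQuasiProjRes (M : A) (P : ChainComplex A ℤ) extends
    IsQuasiProjRes M P : Prop where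
  bddAbove : ∃ b : ℤ, ∀ i, b < i → IsZero (P.X i)

/-- `s` is the supremum of the degrees in which `P` is nonzero. -/
def IsSup (P : ChainComplex A ℤ) (s : ℤ) : Prop :=
  ¬ IsZero (P.X s) ∧ ∀ i, s < i → IsZero (P.X i)

/-- `t` is the supremum of the degrees in which the homology of `P` is nonzero. -/
def IsHSup (P : ChainComplex A ℤ) (t : ℤ) : Prop :=
  ¬ IsZero (P.homology t) ∧ ∀ i, t < i → IsZero (P.homology i)

/-- `t` is the infimum of the degrees in which the homology of `P` is nonzero. -/
def IsHInf (P : ChainComplex A ℤ) (t : ℤ) : Prop :=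
  ¬ IsZero (P.homology t) ∧ ∀ i, i < t → IsZero (P.homology i)

open Classical in
/-- The quasi-projective dimension of `M`, as an element of `ℕ∞`: the infimum of
`sup P• - hsup P•` over all finite quasi-projective resolutions `P•` of `M`
(it is `0` for the zero object and `⊤` if no finite quasi-projective resolution exists). -/
def qpd (M : A) : ℕ∞ :=
  if IsZero M then 0
  else sInf {d : ℕ∞ | ∃ (P : ChainComplex A ℤ) (s t : ℤ),
    IsFiniteQuasiProjRes M P ∧ IsSup P s ∧ IsHSup P t ∧ d = ((s - t).toNat : ℕ∞)}

/-- `M` admits a projective resolution of length at most `n`. -/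
def pdLE (M : A) (n : ℕ) : Prop :=
  ∃ P : ChainComplex A ℤ, (∀ i, Projective (P.X i)) ∧
    (∀ i : ℤ, i < 0 → IsZero (P.X i)) ∧ (∀ i : ℤ, (n : ℤ) < i → IsZero (P.X i)) ∧
    (∀ i : ℤ, i ≠ 0 → IsZero (P.homology i)) ∧ Nonempty (P.homology 0 ≅ M)

/-- The projective dimension of `M`, as an element of `ℕ∞`. -/
def pd (M : A) : ℕ∞ := sInf {d : ℕ∞ | ∃ n : ℕ, d = (n : ℕ∞) ∧ pdLE M n}

open Classical in
/-- Quasi-projective dimension computed using only complexes all of whose terms satisfy the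
predicate `Q` (e.g. `Q` = "finitely generated", for the category of finitely presented
modules over a left coherent ring). -/
def qpdRel (Q : A → Prop) (M : A) : ℕ∞ :=
  if IsZero M then 0
  else sInf {d : ℕ∞ | ∃ (P : ChainComplex A ℤ) (s t : ℤ),
    IsFiniteQuasiProjRes M P ∧ (∀ i, Q (P.X i)) ∧ IsSup P s ∧ IsHSup P t ∧
    d = ((s - t).toNat : ℕ∞)}

/-- Projective dimension computed using only resolutions all of whose terms satisfy the
predicate `Q`. -/
def pdRel (Q : A → Prop) (M : A) : ℕ∞ :=
  sInf {d : ℕ∞ | ∃ n : ℕ, d = (n : ℕ∞) ∧ ∃ P : ChainComplex A ℤ,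
    (∀ i, Projective (P.X i)) ∧ (∀ i, Q (P.X i)) ∧
    (∀ i : ℤ, i < 0 → IsZero (P.X i)) ∧ (∀ i : ℤ, (n : ℤ) < i → IsZero (P.X i)) ∧
    (∀ i : ℤ, i ≠ 0 → IsZero (P.homology i)) ∧ Nonempty (P.homology 0 ≅ M)}

/-- Vanishing of the `n`-th Ext group, `Ext_𝒜^n(M, N) = 0`. -/
def extIsZero [EnoughProjectives A] (M N : A) (n : ℕ) : Prop :=
  IsZero (((_root_.Ext ℤ A n).obj (Opposite.op M)).obj N)

/-- The quasi-projective dimension of a finitely presented module over a (left coherent)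
ring, computed inside the abelian category of finitely presented modules, i.e. via bounded
complexes of finitely generated projective modules. -/
def qpdFG {R : Type u} [Ring R] (M : ModuleCat.{u} R) : ℕ∞ :=
  qpdRel (fun N : ModuleCat.{u} R => Module.Finite R N) M

/-- The projective dimension of a finitely presented module over a (left coherent) ring,
computed inside the abelian category of finitely presented modules. -/
def pdFG {R : Type u} [Ring R] (M : ModuleCat.{u} R) : ℕ∞ :=
  pdRel (fun N : ModuleCat.{u} R => Module.Finite R N) M

/-- A ring is left coherent if every finitely generated left ideal is finitely presented. -/
def IsLeftCoherent (R : Type u) [Ring R] : Prop :=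
  ∀ I : Ideal R, I.FG → Module.FinitePresentation R I

/-- The quasi-global dimension of a ring: the supremum of the quasi-projective dimensions
of all finitely generated left modules. -/
def qgldim (R : Type u) [Ring R] : ℕ∞ :=
  sSup {d : ℕ∞ | ∃ M : ModuleCat.{u} R, Module.Finite R M ∧ d = qpd M}

/-- The global dimension of a ring: the supremum of the projective dimensions of all
finitely generated left modules. -/
def gldim (R : Type u) [Ring R] : ℕ∞ :=
  sSup {d : ℕ∞ | ∃ M : ModuleCat.{u} R, Module.Finite R M ∧ d = pd M}

/-- The finitistic dimension of a ring: the supremum of the projective dimensions of all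
finitely generated left modules of finite projective dimension. -/
def findim (R : Type u) [Ring R] : ℕ∞ :=
  sSup {d : ℕ∞ | ∃ M : ModuleCat.{u} R, Module.Finite R M ∧ d = pd M ∧ pd M ≠ ⊤}

/-- The depth of a module over a Noetherian local ring:
`depth M = inf {i : Ext^i(R/𝔪, M) ≠ 0}`. -/
def depth {R : Type u} [CommRing R] [IsLocalRing R] (M : ModuleCat.{u} R) : ℕ∞ :=
  sInf {d : ℕ∞ | ∃ n : ℕ, d = (n : ℕ∞) ∧
    ¬ IsZero (((_root_.Ext ℤ (ModuleCat.{u} R) n).obj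
      (Opposite.op (ModuleCat.of R (IsLocalRing.ResidueField R)))).obj M)}

end QPD

end

namespace QPD

section

variable {A : Type*} [Category A] [Abelian A]

lemma copies_zero_isZero (M : A) : IsZero (copies M 0) := by
  rw [IsZero.iff_id_eq_zero]
  exact biproduct.hom_ext _ _ (fun j => j.elim0)

/-- The direct sum of one copy of `M` is `M`. -/
noncomputable def copiesOneIso (M : A) : copies M 1 ≅ M :=
  biproductUniqueIso (fun _ : Fin 1 => M)

/-- A finite quasi-projective resolution whose homology lives in top degree `t` and which vanishes
above degree `s` bounds the quasi-projective dimension by `s - t`. -/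
lemma qpd_le_of_isFiniteQuasiProjRes {M : A} {Q : ChainComplex A ℤ}
    (hQ : IsFiniteQuasiProjRes M Q) {s t : ℤ} (hs : ∀ i, s < i → IsZero (Q.X i))
    (ht : IsHSup Q t) : qpd M ≤ ((s - t).toNat : ℕ∞) := by
  classical
  rw [qpd]
  split_ifs with hM
  · simp
  have hXt : ¬ IsZero (Q.X t) := fun h =>
    ht.1 (ShortComplex.exact_iff_isZero_homology _ |>.1 (ShortComplex.exact_of_isZero_X₂ _ h))
  obtain ⟨s', hs', hmax⟩ := Int.exists_greatest_of_bdd (P := fun i => ¬ IsZero (Q.X i))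
    ⟨s, fun i hi => not_lt.1 fun h => hi (hs i h)⟩ ⟨t, hXt⟩
  have hs's : s' ≤ s := not_lt.1 fun h => hs' (hs s' h)
  have hsup : IsSup Q s' := ⟨hs', fun i hi => by
    by_contra h
    exact absurd (hmax i h) (not_le.2 hi)⟩
  refine (sInf_le (a := ((s' - t).toNat : ℕ∞)) (by exact ⟨Q, s', t, hQ, hsup, ht, rfl⟩)).trans ?_
  exact_mod_cast Int.toNat_le_toNat (by lia)

end

end QPD

section Truncation

/-- The embedding of `up ℕ` into `down ℤ` which sends `k` to `N - k`; truncating along it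
replaces the term of degree `N` by the opcycles and kills the terms of higher degree. -/
def ComplexShape.embeddingDownIntLE (N : ℤ) :
    ComplexShape.Embedding (ComplexShape.up ℕ) (ComplexShape.down ℤ) :=
  ComplexShape.Embedding.mk' _ _ (fun k => N - k)
    (fun _ _ h => by dsimp at h; lia)
    (fun _ _ => by simp only [ComplexShape.up_Rel, ComplexShape.down_Rel]; lia)

@[simp]
lemma ComplexShape.embeddingDownIntLE_f (N : ℤ) (k : ℕ) :
    (ComplexShape.embeddingDownIntLE N).f k = N - k := rfl

instance (N : ℤ) : (ComplexShape.embeddingDownIntLE N).IsRelIff where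
  rel' _ _ h := by
    simp only [ComplexShape.embeddingDownIntLE_f, ComplexShape.down_Rel,
      ComplexShape.up_Rel] at h ⊢
    lia

instance (N : ℤ) : (ComplexShape.embeddingDownIntLE N).IsTruncGE where
  mem_next {j _} h := ⟨j + 1, by
    simp only [ComplexShape.embeddingDownIntLE_f, ComplexShape.down_Rel] at h ⊢; lia⟩

variable {A : Type*} [Category A] [Abelian A]

namespace ChainComplex

open ComplexShape

/-- The truncation of a chain complex in degrees at most `N`, with the opcycles in degree `N`. -/
noncomputable abbrev truncBelow (K : ChainComplex A ℤ) (N : ℤ) : ChainComplex A ℤ :=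
  HomologicalComplex.truncGE K (embeddingDownIntLE N)

variable (K : ChainComplex A ℤ) (N : ℤ)

lemma isZero_truncBelow_X {i : ℤ} (hi : N < i) : IsZero ((truncBelow K N).X i) :=
  HomologicalComplex.isZero_extend_X _ _ _ fun k => by
    simp only [embeddingDownIntLE_f]; lia

lemma boundaryGE_embeddingDownIntLE_iff (k : ℕ) :
    (embeddingDownIntLE N).BoundaryGE k ↔ k = 0 := by
  constructor
  · intro h
    by_contra hk
    refine h.2 (k - 1) ?_
    have := h.1
    simp only [embeddingDownIntLE_f, down_Rel] at this ⊢
    have e : (down ℤ).prev (N - k) = N - k + 1 := by simp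
    lia
  · rintro rfl
    refine ⟨?_, fun i => ?_⟩
    · simp
    · simp
      lia

lemma projective_truncBelow_X (h : ∀ i, i < N → Projective (K.X i))
    (hN : Projective (K.opcycles N)) (i : ℤ) : Projective ((truncBelow K N).X i) := by
  rcases lt_trichotomy i N with hi | rfl | hi
  · obtain ⟨k, hk⟩ := Int.eq_ofNat_of_zero_le (a := N - i) (by lia)
    refine Projective.of_iso (K.truncGEXIso (embeddingDownIntLE N) (i := k) (i' := i) ?_ ?_).symm
      (h i hi)
    · simp only [embeddingDownIntLE_f]; lia
    · rw [boundaryGE_embeddingDownIntLE_iff]; lia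
  · refine Projective.of_iso (K.truncGEXIsoOpcycles (embeddingDownIntLE i) (i := 0) ?_ ?_).symm hN
    · simp
    · rw [boundaryGE_embeddingDownIntLE_iff]
  · exact (isZero_truncBelow_X K N hi).projective

lemma isZero_truncBelow_X_of_isZero {i : ℤ} (hi : i < N) (h : IsZero (K.X i)) :
    IsZero ((truncBelow K N).X i) := by
  obtain ⟨k, hk⟩ := Int.eq_ofNat_of_zero_le (a := N - i) (by lia)
  refine h.of_iso (K.truncGEXIso (embeddingDownIntLE N) (i := k) (i' := i) ?_ ?_)
  · simp only [embeddingDownIntLE_f]; lia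
  · rw [boundaryGE_embeddingDownIntLE_iff]; lia

/-- Truncation does not change the homology in degrees at most `N`. -/
noncomputable def truncBelowHomologyIso {i : ℤ} (hi : i ≤ N) :
    K.homology i ≅ (truncBelow K N).homology i :=
  haveI : QuasiIsoAt (K.πTruncGE (embeddingDownIntLE N)) i :=
    K.quasiIsoAt_πTruncGE _ (j := (N - i).toNat) (by simp only [embeddingDownIntLE_f]; lia)
  isoOfQuasiIsoAt (K.πTruncGE (embeddingDownIntLE N)) i

lemma isZero_truncBelow_homology {i : ℤ} (hi : N < i) :
    IsZero ((truncBelow K N).homology i) :=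
  ShortComplex.exact_iff_isZero_homology _ |>.1
    (ShortComplex.exact_of_isZero_X₂ _ (isZero_truncBelow_X K N hi))

end ChainComplex

end Truncation

section LongExactSequence

variable {A ι : Type*} [Category A] [Abelian A] {c : ComplexShape ι}
  {S : ShortComplex (HomologicalComplex A c)}

namespace CategoryTheory.ShortComplex.ShortExact

lemma isIso_homologyMap_f (hS : S.ShortExact) {i j : ι} (hij : c.Rel i j)
    (hi : IsZero (S.X₃.homology i)) (hj : IsZero (S.X₃.homology j)) :
    IsIso (HomologicalComplex.homologyMap S.f j) := by
  have := (hS.homology_exact₁ i j hij).mono_g (hi.eq_of_src _ _)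
  have := (hS.homology_exact₂ j).epi_f (hj.eq_of_tgt _ _)
  exact isIso_of_mono_of_epi _

lemma isIso_homologyMap_g (hS : S.ShortExact) {i j : ι} (hij : c.Rel i j)
    (hi : IsZero (S.X₁.homology i)) (hj : IsZero (S.X₁.homology j)) :
    IsIso (HomologicalComplex.homologyMap S.g i) := by
  have := (hS.homology_exact₂ i).mono_g (hi.eq_of_src _ _)
  have := (hS.homology_exact₃ i j hij).epi_f (hj.eq_of_tgt _ _)
  exact isIso_of_mono_of_epi _

lemma isZero_homology_X₂ (hS : S.ShortExact) {i : ι}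
    (h₁ : IsZero (S.X₁.homology i)) (h₃ : IsZero (S.X₃.homology i)) :
    IsZero (S.X₂.homology i) :=
  (hS.homology_exact₂ i).isZero_of_both_zeros (h₁.eq_of_src _ _) (h₃.eq_of_tgt _ _)

end CategoryTheory.ShortComplex.ShortExact

end LongExactSequence

namespace ChainComplex

variable {A : Type*} [Category A] [Abelian A]

/-- The complex with `K.X (i - a)` in degree `i` and differential multiplied by the sign `ε`. -/
@[simps]
def signedShift (K : ChainComplex A ℤ) (a : ℤ) (ε : ℤˣ) : ChainComplex A ℤ where
  X i := K.X (i - a)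
  d i j := ε • K.d (i - a) (j - a)
  shape i j h := by
    rw [K.shape _ _ (by simp only [ComplexShape.down_Rel] at h ⊢; lia), smul_zero]
  d_comp_d' i j k _ _ := by simp

/-- Multiplication by a sign, as an automorphism. -/
@[simps]
def signIso (X : A) (ε : ℤˣ) : X ≅ X where
  hom := ε • 𝟙 X
  inv := ε • 𝟙 X
  hom_inv_id := by simp [smul_smul]
  inv_hom_id := by simp [smul_smul]

/-- The homology of a signed shift is the shifted homology. -/
noncomputable def signedShiftHomologyIso (K : ChainComplex A ℤ) (a : ℤ) (ε : ℤˣ) (i : ℤ) :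
    (signedShift K a ε).homology i ≅ K.homology (i - a) :=
  (signedShift K a ε).homologyIsoSc' (i + 1) i (i - 1) (by simp) (by simp) ≪≫
    ShortComplex.homologyMapIso (ShortComplex.isoMk
      (S₁ := (signedShift K a ε).sc' (i + 1) i (i - 1))
      (S₂ := K.sc' (i + 1 - a) (i - a) (i - 1 - a))
      (signIso (K.X (i + 1 - a)) ε) (Iso.refl (K.X (i - a))) (signIso (K.X (i - 1 - a)) ε)
      (by
        change (ε • 𝟙 (K.X (i + 1 - a))) ≫ K.d (i + 1 - a) (i - a) =
          (ε • K.d (i + 1 - a) (i - a)) ≫ 𝟙 (K.X (i - a))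
        simp)
      (by
        change 𝟙 (K.X (i - a)) ≫ K.d (i - a) (i - 1 - a) =
          (ε • K.d (i - a) (i - 1 - a)) ≫ (ε • 𝟙 (K.X (i - 1 - a)))
        simp [smul_smul])) ≪≫
    (K.homologyIsoSc' (i + 1 - a) (i - a) (i - 1 - a) (by simp; lia) (by simp; lia)).symm

/-- A chain map `K ⟶ K[n]` of degree `-n`, given by its components. -/
structure ShiftMap (K : ChainComplex A ℤ) (n : ℤ) where
  /-- The components of the chain map. -/
  f (i j : ℤ) (h : j + n = i) : K.X i ⟶ K.X j
  comm (i j i' j' : ℤ) (h : j + n = i) (h' : j' + n = i') (hi : i' + 1 = i) :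
    f i j h ≫ K.d j j' = K.d i i' ≫ f i' j' h'

namespace ShiftMap

variable {K : ChainComplex A ℤ} {n : ℤ} (g : ShiftMap K n)

/-- The mapping cone of `g : K ⟶ K[n]`, with `K.X (i - 1) ⊞ K.X (i - n)` in degree `i`. -/
noncomputable def cone : ChainComplex A ℤ where
  X i := K.X (i - 1) ⊞ K.X (i - n)
  d i j := biprod.lift (biprod.fst ≫ K.d (i - 1) (j - 1))
    ((if h : j + 1 = i then biprod.fst ≫ g.f (i - 1) (j - n) (by lia) else 0) -
      biprod.snd ≫ K.d (i - n) (j - n))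
  shape i j h := by
    simp only [ComplexShape.down_Rel] at h
    rw [dif_neg h, K.shape _ _ (by simp only [ComplexShape.down_Rel]; lia),
      K.shape _ _ (by simp only [ComplexShape.down_Rel]; lia)]
    apply biprod.hom_ext <;> simp
  d_comp_d' i j k hij hjk := by
    simp only [ComplexShape.down_Rel] at hij hjk
    rw [dif_pos hij, dif_pos hjk]
    apply biprod.hom_ext
    · simp
    · simp [g.comm (i - 1) (j - n) (j - 1) (k - n) (by lia) (by lia) (by lia)]

/-- The first projection from the cone. -/
noncomputable def fst (i : ℤ) : g.cone.X i ⟶ K.X (i - 1) :=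
  (biprod.fst : K.X (i - 1) ⊞ K.X (i - n) ⟶ _)

/-- The second projection from the cone. -/
noncomputable def snd (i : ℤ) : g.cone.X i ⟶ K.X (i - n) :=
  (biprod.snd : K.X (i - 1) ⊞ K.X (i - n) ⟶ _)

/-- The first inclusion into the cone. -/
noncomputable def inl (i : ℤ) : K.X (i - 1) ⟶ g.cone.X i :=
  (biprod.inl : _ ⟶ K.X (i - 1) ⊞ K.X (i - n))

/-- The second inclusion into the cone. -/
noncomputable def inr (i : ℤ) : K.X (i - n) ⟶ g.cone.X i :=
  (biprod.inr : _ ⟶ K.X (i - 1) ⊞ K.X (i - n))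

@[simp]
lemma inl_fst (i : ℤ) : g.inl i ≫ g.fst i = 𝟙 _ := biprod.inl_fst

@[simp]
lemma inl_snd (i : ℤ) : g.inl i ≫ g.snd i = 0 := biprod.inl_snd

@[simp]
lemma inr_fst (i : ℤ) : g.inr i ≫ g.fst i = 0 := biprod.inr_fst

@[simp]
lemma inr_snd (i : ℤ) : g.inr i ≫ g.snd i = 𝟙 _ := biprod.inr_snd

lemma fst_inl_add_snd_inr (i : ℤ) :
    g.fst i ≫ g.inl i + g.snd i ≫ g.inr i = 𝟙 _ := biprod.total

lemma cone_hom_ext {i : ℤ} {Y : A} {f f' : Y ⟶ g.cone.X i} (h : f ≫ g.fst i = f' ≫ g.fst i)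
    (h' : f ≫ g.snd i = f' ≫ g.snd i) : f = f' :=
  biprod.hom_ext (X := K.X (i - 1)) (Y := K.X (i - n)) f f' h h'

lemma cone_d_fst (i j : ℤ) : g.cone.d i j ≫ g.fst j = g.fst i ≫ K.d (i - 1) (j - 1) :=
  biprod.lift_fst _ _

lemma cone_d_snd {i j : ℤ} (h : j + 1 = i) : g.cone.d i j ≫ g.snd j =
    g.fst i ≫ g.f (i - 1) (j - n) (by lia) - g.snd i ≫ K.d (i - n) (j - n) := by
  refine (biprod.lift_snd _ _).trans ?_
  rw [dif_pos h]
  rfl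

lemma inl_cone_d {i j : ℤ} (h : j + 1 = i) : g.inl i ≫ g.cone.d i j =
    K.d (i - 1) (j - 1) ≫ g.inl j + g.f (i - 1) (j - n) (by lia) ≫ g.inr j := by
  apply g.cone_hom_ext <;>
    simp [g.cone_d_fst, g.cone_d_snd h, reassoc_of% g.inl_fst i, reassoc_of% g.inl_snd i]

lemma inr_cone_d {i j : ℤ} (h : j + 1 = i) : g.inr i ≫ g.cone.d i j =
    -K.d (i - n) (j - n) ≫ g.inr j := by
  apply g.cone_hom_ext <;>
    simp [g.cone_d_fst, g.cone_d_snd h, reassoc_of% g.inr_fst i, reassoc_of% g.inr_snd i]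

lemma projective_cone_X (h : ∀ i, Projective (K.X i)) (i : ℤ) : Projective (g.cone.X i) := by
  have := h (i - 1)
  have := h (i - n)
  exact inferInstanceAs (Projective (K.X (i - 1) ⊞ K.X (i - n)))

lemma isZero_cone_X {i : ℤ} (h₁ : IsZero (K.X (i - 1))) (h₂ : IsZero (K.X (i - n))) :
    IsZero (g.cone.X i) :=
  (IsZero.iff_id_eq_zero _).2 (g.cone_hom_ext (h₁.eq_of_tgt _ _) (h₂.eq_of_tgt _ _))

/-- The degreewise split short exact sequence `0 ⟶ K[n] ⟶ cone g ⟶ K[1] ⟶ 0`. -/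
noncomputable def coneSequence : ShortComplex (ChainComplex A ℤ) where
  X₁ := signedShift K n (-1)
  X₂ := g.cone
  X₃ := signedShift K 1 1
  f :=
    { f i := g.inr i
      comm' i j h := by
        refine (g.inr_cone_d h).trans ?_
        change _ = ((-1 : ℤˣ) • K.d (i - n) (j - n)) ≫ g.inr j
        simp }
  g :=
    { f i := g.fst i
      comm' i j h := by
        refine Eq.trans ?_ (g.cone_d_fst i j).symm
        change g.fst i ≫ ((1 : ℤˣ) • K.d (i - 1) (j - 1)) = _
        simp }
  zero := by
    ext i
    exact g.inr_fst i

lemma coneSequence_shortExact : g.coneSequence.ShortExact :=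
  HomologicalComplex.shortExact_of_degreewise_shortExact _ fun i =>
    ShortComplex.Splitting.shortExact
      { r := g.snd i
        s := g.inl i
        f_r := g.inr_snd i
        s_g := g.inl_fst i
        id := (add_comm _ _).trans (g.fst_inl_add_snd_inr i) }

/-- If `K` is a resolution and `n ≥ 2`, then the cone of a map `K ⟶ K[n]` has the resolved object
as its homology in degree `1`. -/
lemma nonempty_cone_homology_one_iso (hK : ∀ i, i ≠ 0 → IsZero (K.homology i)) (hn : 2 ≤ n) :
    Nonempty (g.cone.homology 1 ≅ K.homology 0) := by
  have := g.coneSequence_shortExact.isIso_homologyMap_g (i := 1) (j := 0) (by simp)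
    ((hK _ (by lia)).of_iso (signedShiftHomologyIso K n (-1) 1))
    ((hK _ (by lia)).of_iso (signedShiftHomologyIso K n (-1) 0))
  let e : g.coneSequence.X₂.homology 1 ≅ g.coneSequence.X₃.homology 1 :=
    asIso (HomologicalComplex.homologyMap g.coneSequence.g 1)
  exact ⟨e ≪≫ signedShiftHomologyIso K 1 1 1⟩

/-- If `K` is a resolution and `n ≥ 2`, then the cone of a map `K ⟶ K[n]` has the resolved object
as its homology in degree `n`. -/
lemma nonempty_cone_homology_shift_iso (hK : ∀ i, i ≠ 0 → IsZero (K.homology i)) (hn : 2 ≤ n) :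
    Nonempty (g.cone.homology n ≅ K.homology 0) := by
  have := g.coneSequence_shortExact.isIso_homologyMap_f (i := n + 1) (j := n) (by simp)
    ((hK _ (by lia)).of_iso (signedShiftHomologyIso K 1 1 (n + 1)))
    ((hK _ (by lia)).of_iso (signedShiftHomologyIso K 1 1 n))
  let e : g.coneSequence.X₁.homology n ≅ g.coneSequence.X₂.homology n :=
    asIso (HomologicalComplex.homologyMap g.coneSequence.f n)
  exact ⟨e.symm ≪≫ signedShiftHomologyIso K n (-1) n ≪≫ eqToIso (by rw [sub_self])⟩

lemma isZero_cone_homology (hK : ∀ i, i ≠ 0 → IsZero (K.homology i)) {i : ℤ} (h₁ : i ≠ 1)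
    (hn : i ≠ n) : IsZero (g.cone.homology i) :=
  g.coneSequence_shortExact.isZero_homology_X₂
    ((hK _ (by lia)).of_iso (signedShiftHomologyIso K n (-1) i))
    ((hK _ (by lia)).of_iso (signedShiftHomologyIso K 1 1 i))

/-- If `g` induces an isomorphism between the cokernels of the differentials ending in degrees `N`
and `N - n`, then the opcycles of its cone in degree `N` are a retract of `K.X (N - 1)`. -/
noncomputable def opcyclesConeRetract (N : ℤ)
    (w : K.d (N + 1 - 1 + 1) (N + 1 - 1) ≫ g.f (N + 1 - 1) (N - n) (by lia) =
      g.f (N + 1 - 1 + 1) (N + 1 - n) (by lia) ≫ K.d (N + 1 - n) (N - n))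
    [IsIso (cokernel.map _ _ _ _ w)] :
    Retract (g.cone.opcycles N) (K.X (N - 1)) where
  i := g.cone.descOpcycles (g.fst N - g.snd N ≫ cokernel.π (K.d (N + 1 - n) (N - n)) ≫
      inv (cokernel.map _ _ _ _ w) ≫ cokernel.desc _ (K.d (N + 1 - 1) (N - 1)) (by simp))
    (N + 1) (by simp) (by
      have hπ : g.f (N + 1 - 1) (N - n) (by lia) ≫ cokernel.π (K.d (N + 1 - n) (N - n)) ≫
          inv (cokernel.map _ _ _ _ w) = cokernel.π (K.d (N + 1 - 1 + 1) (N + 1 - 1)) := by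
        rw [← Category.assoc, IsIso.comp_inv_eq]
        simp
      rw [Preadditive.comp_sub, g.cone_d_fst, ← Category.assoc, g.cone_d_snd rfl]
      simp [reassoc_of% hπ])
  r := g.inl N ≫ g.cone.pOpcycles N
  retract := by
    have hinr : K.d (N + 1 - n) (N - n) ≫ g.inr N ≫ g.cone.pOpcycles N = 0 := by
      have h := congrArg (· ≫ g.cone.pOpcycles N) (g.inr_cone_d (i := N + 1) (j := N) rfl)
      simpa using h.symm
    have hinl : K.d (N + 1 - 1) (N - 1) ≫ g.inl N ≫ g.cone.pOpcycles N =
        -(g.f (N + 1 - 1) (N - n) (by lia) ≫ g.inr N ≫ g.cone.pOpcycles N) := by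
      have h := congrArg (· ≫ g.cone.pOpcycles N) (g.inl_cone_d (i := N + 1) (j := N) rfl)
      exact eq_neg_of_add_eq_zero_left (by simpa using h.symm)
    have hδ : cokernel.desc (K.d (N + 1 - 1 + 1) (N + 1 - 1)) (K.d (N + 1 - 1) (N - 1))
        (by simp) ≫ g.inl N ≫ g.cone.pOpcycles N =
          -(cokernel.map _ _ _ _ w ≫ cokernel.desc _ _ hinr) := by
      rw [← cancel_epi (cokernel.π _)]
      simp [hinl]
    have htotal := congrArg (· ≫ g.cone.pOpcycles N) (g.fst_inl_add_snd_inr N)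
    rw [← cancel_epi (g.cone.pOpcycles N)]
    simpa [hδ] using htotal

end ShiftMap

end ChainComplex

open QPD in
/-- If a deleted projective resolution `P•` of `M` admits a chain map
`g• : P• → P•[n]` (`n ≥ 2`) inducing an isomorphism `Ω^{n+m}(M) → Ω^{m}(M)` (syzygies
realized as the cokernels `Coker(d_{j+1} : P_{j+1} → P_j)`), then `qpd M ≤ m`. -/
theorem qpd_le_of_chain_map_shift {A : Type*} [Category A] [Abelian A] [EnoughProjectives A]
    (M : A) (P : ChainComplex A ℤ)
    (hproj : ∀ i, Projective (P.X i))
    (hneg : ∀ i : ℤ, i < 0 → IsZero (P.X i))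
    (hres0 : Nonempty (P.homology 0 ≅ M))
    (hres : ∀ i : ℤ, i ≠ 0 → IsZero (P.homology i))
    (n : ℕ) (hn : 2 ≤ n) (m : ℕ)
    (g : ∀ i j : ℤ, j + (n : ℤ) = i → (P.X i ⟶ P.X j))
    (hg : ∀ (i j : ℤ) (h : j + (n : ℤ) = i),
      g i j h ≫ P.d j (j - 1) = P.d i (i - 1) ≫ g (i - 1) (j - 1) (by omega))
    (hg0 : ∀ (i j : ℤ) (h : j + (n : ℤ) = i), j < 0 → g i j h = 0)
    (w : P.d ((n : ℤ) + m + 1) ((n : ℤ) + m) ≫ g ((n : ℤ) + m) (m : ℤ) (by ring) =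
      g ((n : ℤ) + m + 1) ((m : ℤ) + 1) (by ring) ≫ P.d ((m : ℤ) + 1) (m : ℤ))
    (hiso : IsIso (cokernel.map (P.d ((n : ℤ) + m + 1) ((n : ℤ) + m))
      (P.d ((m : ℤ) + 1) (m : ℤ)) (g ((n : ℤ) + m + 1) ((m : ℤ) + 1) (by ring))
      (g ((n : ℤ) + m) (m : ℤ) (by ring)) w)) :
    qpd M ≤ (m : ℕ∞) := by
  let γ : P.ShiftMap n :=
    { f := g
      comm i j i' j' h h' hi := by
        obtain rfl : i' = i - 1 := by lia
        obtain rfl : j' = j - 1 := by lia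
        exact hg i j h }
  have hcoker : ∀ (i i' j j' : ℤ) (h : j + (n : ℤ) = i) (h' : j' + (n : ℤ) = i'),
      i = (n : ℤ) + m → i' = (n : ℤ) + m + 1 →
      ∀ w : P.d i' i ≫ g i j h = g i' j' h' ≫ P.d j' j, IsIso (cokernel.map _ _ _ _ w) := by
    intro i i' j j' h h' hi hi' w
    obtain rfl : j = m := by lia
    obtain rfl : j' = m + 1 := by lia
    subst hi hi'
    exact hiso
  let N : ℤ := n + m
  have w' : P.d (N + 1 - 1 + 1) (N + 1 - 1) ≫ γ.f (N + 1 - 1) (N - n) (by lia) =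
      γ.f (N + 1 - 1 + 1) (N + 1 - n) (by lia) ≫ P.d (N + 1 - n) (N - n) :=
    (γ.comm _ _ _ _ _ _ (by lia)).symm
  have := hcoker _ _ _ _ _ _ (by lia) (by lia) w'
  have hopcycles : Projective (γ.cone.opcycles N) :=
    have := hproj (N - 1)
    (γ.opcyclesConeRetract N w').projective
  let T := γ.cone.truncBelow N
  obtain ⟨e₀⟩ := hres0
  obtain ⟨e₁⟩ := γ.nonempty_cone_homology_one_iso hres (by lia)
  obtain ⟨eₙ⟩ := γ.nonempty_cone_homology_shift_iso hres (by lia)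
  have hT₁ : T.homology 1 ≅ M := (γ.cone.truncBelowHomologyIso N (by lia)).symm ≪≫ e₁ ≪≫ e₀
  have hTₙ : T.homology n ≅ M := (γ.cone.truncBelowHomologyIso N (by lia)).symm ≪≫ eₙ ≪≫ e₀
  have hT : ∀ i : ℤ, i ≠ 1 → i ≠ n → IsZero (T.homology i) := fun i h₁ hₙ => by
    rcases le_or_gt i N with hi | hi
    · exact (γ.isZero_cone_homology hres h₁ hₙ).of_iso (γ.cone.truncBelowHomologyIso N hi).symm
    · exact γ.cone.isZero_truncBelow_homology N hi
  by_cases hM : IsZero M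
  · simp [qpd, hM]
  have hQ : IsFiniteQuasiProjRes M T :=
    { projective := γ.cone.projective_truncBelow_X N (fun i _ => γ.projective_cone_X hproj i)
        hopcycles
      bddBelow := ⟨0, fun i hi => γ.cone.isZero_truncBelow_X_of_isZero N (by lia)
        (γ.isZero_cone_X (hneg _ (by lia)) (hneg _ (by lia)))⟩
      homology_iso := by
        refine ⟨fun j => if j = 1 ∨ j = n then 1 else 0, ⟨1, by simp⟩, fun j => ?_⟩
        by_cases h₁ : j = 1
        · subst h₁
          exact ⟨hT₁ ≪≫ (copiesOneIso M).symm ≪≫ eqToIso (by simp)⟩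
        by_cases hₙ : j = n
        · subst hₙ
          exact ⟨hTₙ ≪≫ (copiesOneIso M).symm ≪≫ eqToIso (by simp)⟩
        · simp only [h₁, hₙ, or_self, if_false]
          exact ⟨(hT j h₁ hₙ).iso (copies_zero_isZero M)⟩
      bddAbove := ⟨N, fun i hi => γ.cone.isZero_truncBelow_X N hi⟩ }
  have hsup : IsHSup T n :=
    ⟨fun h => hM (h.of_iso hTₙ.symm), fun i hi => hT i (by lia) (by lia)⟩
  refine (qpd_le_of_isFiniteQuasiProjRes hQ (s := N)
    (fun i hi => γ.cone.isZero_truncBelow_X N hi) hsup).trans ?_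
  have hN : N - n = m := by lia
  rw [hN, Int.toNat_natCast]
end

section
/- Let R be a left coherent ring and let M be a finitely presented left R-module whose quasi-projective dimension in the abelian category of finitely presented left R-modules is finite. If Ext_R^n(M, M ⊕ R) = 0 for all integers n ≥ 1, then M is projective. -/
/-!
Quasi-projective dimension, following Gheibi–Jorgensen–Takahashi and
Chen–Chen–Liu, "Properties of quasi-projective dimension over abelian categories".
-/

open CategoryTheory CategoryTheory.Limits

attribute [local instance] CategoryTheory.Abelian.hasFiniteBiproducts

universe w

namespace QPD

section Abelian

variable {C : Type*} [Category* C] [Abelian C]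

/-- Vanishing of the derived-functor `Ext` in positive degree implies vanishing of the
derived-category `Ext`. -/
theorem subsingleton_ext_of_extIsZero [EnoughProjectives C] [HasExt.{w} C] {M N : C} {n : ℕ}
    (h : extIsZero M N (n + 1)) : Subsingleton (Abelian.Ext.{w} M N (n + 1)) := by
  let Q := projectiveResolution M
  have hz : IsZero ((Q.complex.linearYonedaObj ℤ N).homology (n + 1)) :=
    IsZero.of_iso h (Q.isoExt (R := ℤ) (n + 1) N).symm
  rw [← HomologicalComplex.exactAt_iff_isZero_homology,
    HomologicalComplex.exactAt_iff' _ n (n + 1) (n + 2) (by simp) (by simp),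
    ShortComplex.moduleCat_exact_iff] at hz
  refine subsingleton_of_forall_eq 0 fun α => ?_
  obtain ⟨f, hf, rfl⟩ := Q.extMk_surjective α (n + 2) rfl
  rw [Q.extMk_eq_zero_iff f (n + 2) rfl hf n rfl]
  exact hz f hf

variable [HasExt.{w} C]

/-- All higher `Ext` groups from `M` to `N` vanish. -/
def ExtAcyclic (M N : C) : Prop := ∀ n : ℕ, Subsingleton (Abelian.Ext.{w} M N (n + 1))

theorem ExtAcyclic.of_retract {M X Y : C} (hY : ExtAcyclic M Y) (r : Retract X Y) :
    ExtAcyclic M X := by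
  refine fun n => subsingleton_of_forall_eq 0 fun x => ?_
  have := hY n
  rw [← x.comp_mk₀_id, ← r.retract, ← Abelian.Ext.mk₀_comp_mk₀,
    ← Abelian.Ext.comp_assoc_of_second_deg_zero,
    Subsingleton.elim (x.comp (Abelian.Ext.mk₀ r.i) (add_zero _)) 0, Abelian.Ext.zero_comp]

theorem ExtAcyclic.of_isZero {M X : C} (hX : IsZero X) : ExtAcyclic M X := by
  refine fun n => subsingleton_of_forall_eq 0 fun x => ?_
  rw [← x.comp_mk₀_id, hX.eq_of_src (𝟙 X) 0, Abelian.Ext.mk₀_zero, Abelian.Ext.comp_zero]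

theorem ExtAcyclic.biproduct {M : C} {J : Type*} [Fintype J] {X : J → C}
    (hX : ∀ j, ExtAcyclic M (X j)) : ExtAcyclic M (⨁ X) := fun n =>
  have := fun j => hX j n
  (Abelian.Ext.addEquivBiproduct M (biproduct.isBilimit X) (n + 1)).toEquiv.subsingleton

theorem ExtAcyclic.middle {M : C} {S : ShortComplex C} (hS : S.ShortExact)
    (h₁ : ExtAcyclic M S.X₁) (h₃ : ExtAcyclic M S.X₃) : ExtAcyclic M S.X₂ := by
  refine fun n => subsingleton_of_forall_eq 0 fun x => ?_
  have := h₁ n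
  have := h₃ n
  obtain ⟨y, rfl⟩ := Abelian.Ext.covariant_sequence_exact₂ M hS x (Subsingleton.elim _ _)
  rw [Subsingleton.elim y 0, Abelian.Ext.zero_comp]

theorem ExtAcyclic.right {M : C} {S : ShortComplex C} (hS : S.ShortExact)
    (h₁ : ExtAcyclic M S.X₁) (h₂ : ExtAcyclic M S.X₂) : ExtAcyclic M S.X₃ := by
  refine fun n => subsingleton_of_forall_eq 0 fun x => ?_
  have := h₁ (n + 1)
  have := h₂ n
  obtain ⟨y, rfl⟩ := Abelian.Ext.covariant_sequence_exact₃ M hS x rfl (Subsingleton.elim _ _)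
  rw [Subsingleton.elim y 0, Abelian.Ext.zero_comp]

theorem ExtAcyclic.exists_lift {M : C} {S : ShortComplex C} (hS : S.ShortExact)
    (h₁ : ExtAcyclic M S.X₁) (f : M ⟶ S.X₃) : ∃ g : M ⟶ S.X₂, g ≫ S.g = f := by
  have := h₁ 0
  obtain ⟨y, hy⟩ := Abelian.Ext.covariant_sequence_exact₃ M hS (Abelian.Ext.mk₀ f) rfl
    (Subsingleton.elim _ _)
  obtain ⟨g, rfl⟩ := (Abelian.Ext.mk₀_bijective M S.X₂).2 y
  rw [Abelian.Ext.mk₀_comp_mk₀] at hy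
  exact ⟨g, (Abelian.Ext.mk₀_bijective M S.X₃).1 hy⟩

end Abelian

section Complex

variable {C : Type*} [Category* C] [Abelian C] (P : ChainComplex C ℤ)

/-- The short complex `B_i ⟶ Z_i ⟶ H_i` of boundaries, cycles and homology. -/
noncomputable def boundariesCycles (i : ℤ) : ShortComplex C :=
  ShortComplex.mk (kernel.ι (P.homologyπ i)) (P.homologyπ i) (kernel.condition _)

theorem boundariesCycles_shortExact (i : ℤ) : (boundariesCycles P i).ShortExact where
  exact := ShortComplex.exact_of_f_is_kernel _ (kernelIsKernel _)
  mono_f := equalizer.ι_mono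
  epi_g := inferInstanceAs (Epi (P.homologyπ i))

/-- The short complex `Z_j ⟶ P_j ⟶ B_i` for `j = i + 1`. -/
noncomputable def cyclesBoundaries (i : ℤ) : ShortComplex C :=
  ShortComplex.mk (P.iCycles (i + 1))
    (kernel.lift (P.homologyπ i) (P.toCycles (i + 1) i) (P.toCycles_comp_homologyπ _ _))
    (by rw [← cancel_mono (kernel.ι _), ← cancel_mono (P.iCycles i)]; simp)

theorem cyclesBoundaries_shortExact (i : ℤ) : (cyclesBoundaries P i).ShortExact where
  exact := by
    let T := ShortComplex.mk (P.iCycles (i + 1)) (P.d (i + 1) i) (P.iCycles_d _ _)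
    have hT : T.Exact := ShortComplex.exact_of_f_is_kernel _
      (P.cyclesIsKernel (i + 1) i (by simp))
    let φ : cyclesBoundaries P i ⟶ T :=
      { τ₁ := 𝟙 _
        τ₂ := 𝟙 _
        τ₃ := kernel.ι (P.homologyπ i) ≫ P.iCycles i
        comm₁₂ := by simp [T, cyclesBoundaries]
        comm₂₃ := by simp [T, cyclesBoundaries] }
    have : Epi φ.τ₁ := inferInstanceAs (Epi (𝟙 _))
    have : IsIso φ.τ₂ := inferInstanceAs (IsIso (𝟙 _))
    have : Mono φ.τ₃ := inferInstanceAs (Mono (kernel.ι (P.homologyπ i) ≫ P.iCycles i))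
    exact (ShortComplex.exact_iff_of_epi_of_isIso_of_mono φ).2 hT
  mono_f := inferInstanceAs (Mono (P.iCycles (i + 1)))
  epi_g := by
    have hT : (ShortComplex.mk (P.toCycles (i + 1) i) (P.homologyπ i)
        (P.toCycles_comp_homologyπ _ _)).Exact :=
      ShortComplex.exact_of_g_is_cokernel _ (P.homologyIsCokernel (i + 1) i (by simp))
    exact hT.epi_kernelLift

theorem isZero_cycles {i : ℤ} (h : IsZero (P.X i)) : IsZero (P.cycles i) :=
  IsZero.of_mono (P.iCycles i) h

theorem extAcyclic_cycles [HasExt.{w} C] {M : C} (hX : ∀ i, ExtAcyclic M (P.X i))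
    (hH : ∀ i, ExtAcyclic M (P.homology i)) {b : ℤ} (hb : ∀ i, b < i → IsZero (P.X i))
    (i : ℤ) : ExtAcyclic M (kernel (P.homologyπ i)) ∧ ExtAcyclic M (P.cycles i) := by
  have step (i : ℤ) (h : ExtAcyclic M (P.cycles (i + 1))) :
      ExtAcyclic M (kernel (P.homologyπ i)) ∧ ExtAcyclic M (P.cycles i) :=
    have hB : ExtAcyclic M (kernel (P.homologyπ i)) :=
      .right (cyclesBoundaries_shortExact P i) h (hX (i + 1))
    ⟨hB, .middle (boundariesCycles_shortExact P i) hB (hH i)⟩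
  have key (n : ℕ) : ∀ i : ℤ, b < i + n → ExtAcyclic M (P.cycles i) := by
    induction n with
    | zero => exact fun i hi => .of_isZero (isZero_cycles P (hb i (by simpa using hi)))
    | succ n ih => exact fun i hi => (step i (ih (i + 1) (by push_cast at hi; lia))).2
  exact step i (key (b + 1 - i).toNat (i + 1) (by lia))

/-- In a bounded below complex of projectives, the cycles are projective up to and including
the lowest degree with nonzero homology. -/
theorem projective_cycles (hP : ∀ i, Projective (P.X i)) {a : ℤ}
    (ha : ∀ i, i < a → IsZero (P.X i)) {t : ℤ} (ht : ∀ i, i < t → IsZero (P.homology i)) :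
    Projective (P.cycles t) := by
  have key (n : ℕ) : ∀ i : ℤ, i ≤ t → i < a + n → Projective (P.cycles i) := by
    induction n with
    | zero =>
      exact fun i _ hi => (isZero_cycles P (ha i (by simpa using hi))).projective
    | succ n ih =>
      intro i hi hin
      obtain ⟨j, rfl⟩ : ∃ j, i = j + 1 := ⟨i - 1, by lia⟩
      have := ih j (by lia) (by push_cast at hin; lia)
      have hπ : P.homologyπ j = 0 := (ht j (by lia)).eq_of_tgt _ _
      have : IsIso (kernel.ι (P.homologyπ j)) := by rw [hπ]; infer_instance
      have : Projective (cyclesBoundaries P j).X₃ :=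
        Projective.of_iso (asIso (kernel.ι (P.homologyπ j))).symm inferInstance
      have s := (cyclesBoundaries_shortExact P j).splittingOfProjective
      have := hP (j + 1)
      exact Retract.projective (Y := P.X (j + 1)) ⟨P.iCycles (j + 1), s.r, s.f_r⟩
  exact key (t + 1 - a).toNat t le_rfl (by lia)

theorem isZero_copies_zero (M : C) : IsZero (copies M 0) := by
  rw [IsZero.iff_id_eq_zero]
  exact biproduct.hom_ext _ _ fun j => j.elim0

/-- An object with a finite quasi-projective resolution whose terms, like the object itself,
have no higher extensions by it is projective. -/
theorem IsFiniteQuasiProjRes.projective_of_extAcyclic [HasExt.{w} C] {M : C}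
    {P : ChainComplex C ℤ} (hP : IsFiniteQuasiProjRes M P) (hM : ExtAcyclic M M)
    (hX : ∀ i, ExtAcyclic M (P.X i)) : Projective M := by
  obtain ⟨a, ha⟩ := hP.bddBelow
  obtain ⟨b, hb⟩ := hP.bddAbove
  obtain ⟨mult, ⟨j₀, hj₀⟩, hH⟩ := hP.homology_iso
  by_cases hM0 : IsZero M
  · exact hM0.projective
  obtain ⟨t, ht, hmin⟩ := Int.exists_least_of_bdd (P := fun j => mult j ≠ 0)
    ⟨a, fun j hj => by
      by_contra! hja
      have hz : IsZero (P.homology j) :=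
        ShortComplex.isZero_homology_of_isZero_X₂ _ (ha j hja)
      exact hM0 (.of_mono (biproduct.ι (fun _ : Fin (mult j) => M) ⟨0, Nat.pos_of_ne_zero hj⟩)
        (hz.of_iso (hH j).some.symm))⟩ ⟨j₀, hj₀⟩
  have hacyc (i : ℤ) : ExtAcyclic M (P.homology i) :=
    (ExtAcyclic.biproduct fun _ => hM).of_retract (Retract.ofIso (hH i).some)
  have hproj : Projective (P.cycles t) := projective_cycles P hP.projective ha fun i hi => by
    have hi0 : mult i = 0 := by
      by_contra h
      exact (hmin i h).not_gt hi
    have e := (hH i).some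
    rw [hi0] at e
    exact (isZero_copies_zero M).of_iso e
  let k : Fin (mult t) := ⟨0, Nat.pos_of_ne_zero ht⟩
  let e : P.homology t ≅ ⨁ fun _ : Fin (mult t) => M := (hH t).some
  obtain ⟨g, hg⟩ : ∃ g : M ⟶ P.cycles t, g ≫ P.homologyπ t =
      biproduct.ι (fun _ : Fin (mult t) => M) k ≫ e.inv := ExtAcyclic.exists_lift (boundariesCycles_shortExact P t)
    (extAcyclic_cycles P hX hacyc hb t).1 _
  refine Retract.projective (Y := P.cycles t)
    ⟨g, P.homologyπ t ≫ e.hom ≫ biproduct.π (fun _ : Fin (mult t) => M) k, ?_⟩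
  rw [reassoc_of% hg]
  simp

end Complex

theorem ExtAcyclic.of_finite_projective {R : Type u} [Ring R] {M N : ModuleCat.{u} R}
    (hR : ExtAcyclic M (ModuleCat.of R R)) [Module.Finite R N] [Module.Projective R N] :
    ExtAcyclic M N := by
  obtain ⟨n, f, g, -, -, hfg⟩ := Module.Finite.exists_comp_eq_id_of_projective R N
  have r : Retract N (ModuleCat.of R (Fin n → R)) :=
    ⟨ModuleCat.ofHom g, ModuleCat.ofHom f, by rw [← ModuleCat.ofHom_comp, hfg]; rfl⟩
  have e := ModuleCat.biproductIsoPi (fun _ : Fin n => ModuleCat.of R R)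
  exact (ExtAcyclic.biproduct fun _ : Fin n => hR).of_retract (r.trans (Retract.ofIso e.symm))

end QPD

open QPD in
/-- Over a left coherent ring, a finitely presented module of finite
quasi-projective dimension (in the category of finitely presented modules) satisfying
`Ext^n(M, M ⊕ R) = 0` for all `n ≥ 1` is projective. -/
theorem projective_of_qpdFG_lt_top_of_ext_vanishing {R : Type u} [Ring R]
    (hcoh : IsLeftCoherent R) (M : ModuleCat.{u} R) [Module.FinitePresentation R M]
    (hq : qpdFG M < ⊤)
    (hext : ∀ n : ℕ, 1 ≤ n → extIsZero M (M ⊞ (ModuleCat.of R R)) n) :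
    Module.Projective R M := by
  by_cases hM0 : IsZero M
  · exact (IsProjective.iff_projective M).2 hM0.projective
  rw [qpdFG, qpdRel, if_neg hM0, sInf_lt_iff] at hq
  obtain ⟨_, ⟨P, _, _, hP, hfin, -⟩, -⟩ := hq
  have hsum : ExtAcyclic M (M ⊞ ModuleCat.of R R) := fun n =>
    subsingleton_ext_of_extIsZero (hext (n + 1) (by lia))
  have hM : ExtAcyclic M M := hsum.of_retract ⟨biprod.inl, biprod.fst, by simp⟩
  have hR : ExtAcyclic M (ModuleCat.of R R) :=
    hsum.of_retract ⟨biprod.inr, biprod.snd, by simp⟩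
  refine (IsProjective.iff_projective M).2 (hP.projective_of_extAcyclic hM fun i => ?_)
  have := hfin i
  have : Module.Projective R (P.X i) := (IsProjective.iff_projective _).2 (hP.projective i)
  exact hR.of_finite_projective
end
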